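/- For every p ∈ ℕ there exists an odd-sized cake 𝒞 with R(𝒞) ≥ p and M(𝒞) ≥ (3/4)·R(𝒞) − 1/2; consequently the limsup, as p → ∞, of the maximum of M(𝒞)/R(𝒞) over odd-sized cakes 𝒞 with R(𝒞) = p is at least 3/4. -/

import Mathlib

open scoped Classical

noncomputable section

/-- Determinant of the pair of vectors `(q - p, r - p)`. -/
def orientDet (p q r : ℝ × ℝ) : ℝ :=
  (q.1 - p.1) * (r.2 - p.2) - (q.2 - p.2) * (r.1 - p.1)

/-- The orientation `∇ p q r` : `+1` for counterclockwise, `-1` for clockwise, `0` collinear. -/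
def orient (p q r : ℝ × ℝ) : ℝ := Real.sign (orientDet p q r)

/-- A set of points is in general position if no three of its points are collinear. -/
def GenPos (C : Set (ℝ × ℝ)) : Prop :=
  ∀ p ∈ C, ∀ q ∈ C, ∀ r ∈ C, p ≠ q → p ≠ r → q ≠ r → orientDet p q r ≠ 0

/-- The extremal points of a finite set `C`. -/
def exPts (C : Finset (ℝ × ℝ)) : Finset (ℝ × ℝ) :=
  C.filter (fun c => c ∉ convexHull ℝ ((C.erase c : Finset (ℝ × ℝ)) : Set (ℝ × ℝ)))

/-- The minimax value (Bob's total, Alice to move) of the convex grabbing game. -/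
def gameM (w : ℝ × ℝ → ℕ) (C : Finset (ℝ × ℝ)) : ℕ :=
  if h : C.card ≤ 1 then 0
  else
    sInf (↑((exPts C).attach.image (fun a =>
      (exPts (C.erase a.1)).attach.sup (fun b =>
        w b.1 + gameM w ((C.erase a.1).erase b.1)))) : Set ℕ)
termination_by C.card
decreasing_by
  have ha : a.1 ∈ C := Finset.mem_of_mem_filter _ a.2
  have hb : b.1 ∈ C.erase a.1 := Finset.mem_of_mem_filter _ b.2
  calc ((C.erase a.1).erase b.1).card
      < (C.erase a.1).card := Finset.card_erase_lt_of_mem hb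
    _ ≤ C.card := Finset.card_erase_le

/-- The minimax value of the game when it is Bob's turn to move. -/
def gameMB (w : ℝ × ℝ → ℕ) (C : Finset (ℝ × ℝ)) : ℕ :=
  (exPts C).sup (fun b => w b + gameM w (C.erase b))

lemma mem_exPts_of_lt {C : Finset (ℝ × ℝ)} {x : ℝ × ℝ} (q : ℝ × ℝ) (c d : ℝ) (hx : x ∈ C)
    (hq : c * q.1 + d * q.2 ≤ c * x.1 + d * x.2)
    (h : ∀ y ∈ C, y ≠ x → y ≠ q → c * y.1 + d * y.2 < c * x.1 + d * x.2) : x ∈ exPts C := by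
  refine Finset.mem_filter.2 ⟨hx, fun hmem => ?_⟩
  obtain ⟨v, hv0, hv1, hvx⟩ := Finset.mem_convexHull'.1 hmem
  have h1 : ∑ y ∈ C.erase x, v y * y.1 = x.1 := by
    simpa [Prod.fst_sum] using congrArg Prod.fst hvx
  have h2 : ∑ y ∈ C.erase x, v y * y.2 = x.2 := by
    simpa [Prod.snd_sum] using congrArg Prod.snd hvx
  have hnn : ∀ y ∈ C.erase x, 0 ≤ v y * (c * x.1 + d * x.2 - (c * y.1 + d * y.2)) := by
    intro y hy
    refine mul_nonneg (hv0 y hy) ?_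
    by_cases hyq : y = q
    · subst hyq; linarith
    · linarith [h y (Finset.mem_of_mem_erase hy) (Finset.ne_of_mem_erase hy) hyq]
  have hsum : ∑ y ∈ C.erase x, v y * (c * x.1 + d * x.2 - (c * y.1 + d * y.2)) = 0 := by
    have : ∀ y, v y * (c * x.1 + d * x.2 - (c * y.1 + d * y.2))
        = v y * (c * x.1 + d * x.2) - (c * (v y * y.1) + d * (v y * y.2)) := fun y => by ring
    simp only [this, Finset.sum_sub_distrib, Finset.sum_add_distrib, ← Finset.sum_mul,
      ← Finset.mul_sum, h1, h2, hv1]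
    ring
  have hz := (Finset.sum_eq_zero_iff_of_nonneg hnn).1 hsum
  have hz' : ∀ y ∈ C.erase x, y ≠ q → v y = 0 := by
    intro y hy hyq
    rcases mul_eq_zero.1 (hz y hy) with h0 | h0
    · exact h0
    · linarith [h y (Finset.mem_of_mem_erase hy) (Finset.ne_of_mem_erase hy) hyq]
  by_cases hqC : q ∈ C.erase x
  · have hvq : v q = 1 := by
      rw [← hv1]; exact (Finset.sum_eq_single_of_mem q hqC hz').symm
    have : q = x := by
      rw [← hvx, Finset.sum_eq_single_of_mem q hqC (fun y hy hyq => by rw [hz' y hy hyq, zero_smul]),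
        hvq, one_smul]
    exact Finset.ne_of_mem_erase hqC this
  · have : ∑ y ∈ C.erase x, v y = 0 :=
      Finset.sum_eq_zero fun y hy => hz' y hy (fun e => hqC (e ▸ hy))
    linarith

lemma mem_exPts_of_orientDet_pos {C : Finset (ℝ × ℝ)} {x : ℝ × ℝ} (q : ℝ × ℝ) (hx : x ∈ C)
    (h : ∀ y ∈ C, y ≠ x → y ≠ q → 0 < orientDet x q y) : x ∈ exPts C := by
  refine mem_exPts_of_lt q (q.2 - x.2) (x.1 - q.1) hx (by nlinarith) fun y hy hyx hyq => ?_
  have := h y hy hyx hyq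
  unfold orientDet at this
  nlinarith

lemma mem_exPts_of_orientDet_neg {C : Finset (ℝ × ℝ)} {x : ℝ × ℝ} (q : ℝ × ℝ) (hx : x ∈ C)
    (h : ∀ y ∈ C, y ≠ x → y ≠ q → orientDet x q y < 0) : x ∈ exPts C := by
  refine mem_exPts_of_lt q (x.2 - q.2) (q.1 - x.1) hx (by nlinarith) fun y hy hyx hyq => ?_
  have := h y hy hyx hyq
  unfold orientDet at this
  nlinarith

lemma orientDet_self_left (p q : ℝ × ℝ) : orientDet p q p = 0 := by
  unfold orientDet; ring

lemma orientDet_rotate (p q r : ℝ × ℝ) : orientDet q r p = orientDet p q r := by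
  unfold orientDet; ring

lemma orientDet_swap (p q r : ℝ × ℝ) : orientDet q p r = -orientDet p q r := by
  unfold orientDet; ring

lemma orientDet_swap_right (p q r : ℝ × ℝ) : orientDet p r q = -orientDet p q r := by
  unfold orientDet; ring

/-- A point in the interior of a triangle spanned by points of `C` is not extremal. -/
lemma notMem_exPts_of_triangle {C : Finset (ℝ × ℝ)} {x p q r : ℝ × ℝ}
    (hp : p ∈ C) (hq : q ∈ C) (hr : r ∈ C) (hpq : 0 < orientDet p q x)
    (hqr : 0 < orientDet q r x) (hrp : 0 < orientDet r p x) : x ∉ exPts C := by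
  intro hx
  refine (Finset.mem_filter.1 hx).2 ?_
  have hpx : p ≠ x := by rintro rfl; exact hpq.ne' (orientDet_self_left _ _)
  have hqx : q ≠ x := by rintro rfl; exact hqr.ne' (orientDet_self_left _ _)
  have hrx : r ≠ x := by rintro rfl; exact hrp.ne' (orientDet_self_left _ _)
  have hsum : 0 < orientDet q r x + orientDet r p x + orientDet p q x := by positivity
  set σ := orientDet q r x + orientDet r p x + orientDet p q x with hσ
  have mem : ∀ y ∈ C, y ≠ x → y ∈ convexHull ℝ ((C.erase x : Finset (ℝ × ℝ)) : Set (ℝ × ℝ)) :=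
    fun y hy hyx => subset_convexHull ℝ _ (Finset.mem_coe.2 (Finset.mem_erase.2 ⟨hyx, hy⟩))
  have key := (convex_convexHull ℝ ((C.erase x : Finset (ℝ × ℝ)) : Set (ℝ × ℝ))).sum_mem
    (t := (Finset.univ : Finset (Fin 3)))
    (w := ![orientDet q r x / σ, orientDet r p x / σ, orientDet p q x / σ]) (z := ![p, q, r])
    (by intro i _; fin_cases i <;> simp <;> positivity)
    (by simp only [Fin.sum_univ_three]; simp; field_simp; rfl)
    (by intro i _; fin_cases i
        exacts [mem p hp hpx, mem q hq hqx, mem r hr hrx])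
  convert key using 1
  simp only [Fin.sum_univ_three]
  have hσ0 : σ ≠ 0 := hsum.ne'
  ext
  · simp
    field_simp
    rw [hσ]; unfold orientDet; ring
  · simp
    field_simp
    rw [hσ]; unfold orientDet; ring

lemma exPts_nonempty {C : Finset (ℝ × ℝ)} (hC : C.Nonempty) : (exPts C).Nonempty := by
  obtain ⟨x, hx⟩ := (C.finite_toSet.isCompact_convexHull (𝕜 := ℝ)).extremePoints_nonempty
    ((convexHull_nonempty_iff (𝕜 := ℝ)).2 (Finset.coe_nonempty.2 hC))
  have hxC : x ∈ C := Finset.mem_coe.1 (extremePoints_convexHull_subset hx)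
  refine ⟨x, Finset.mem_filter.2 ⟨hxC, fun hmem => ?_⟩⟩
  have hconv := ((convex_convexHull ℝ (C : Set (ℝ × ℝ))).mem_extremePoints_iff_convex_sdiff.1 hx).2
  have hsub : ((C.erase x : Finset (ℝ × ℝ)) : Set (ℝ × ℝ)) ⊆ convexHull ℝ (C : Set (ℝ × ℝ)) \ {x} :=
    fun y hy => ⟨subset_convexHull ℝ _
      (Finset.mem_coe.2 (Finset.mem_of_mem_erase (Finset.mem_coe.1 hy))),
      Finset.ne_of_mem_erase (Finset.mem_coe.1 hy)⟩
  exact (convexHull_min hsub hconv hmem).2 rfl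

/-- Bob guarantees `m` if he has an adequate answer to each of Alice's first moves. -/
lemma le_gameM {w : ℝ × ℝ → ℕ} {C : Finset (ℝ × ℝ)} {m : ℕ} (hC : 2 ≤ C.card)
    (h : ∀ a ∈ exPts C, ∃ b ∈ exPts (C.erase a),
      m ≤ w b + gameM w ((C.erase a).erase b)) : m ≤ gameM w C := by
  rw [gameM, dif_neg (by omega)]
  refine le_csInf ?_ ?_
  · obtain ⟨x, hx⟩ := exPts_nonempty (Finset.card_pos.1 (by omega : 0 < C.card))
    exact ⟨_, Finset.mem_coe.2 (Finset.mem_image_of_mem _ (Finset.mem_attach _ ⟨x, hx⟩))⟩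
  · rintro _ hv
    obtain ⟨a, -, rfl⟩ := Finset.mem_image.1 (Finset.mem_coe.1 hv)
    obtain ⟨b, hb, hm⟩ := h a.1 a.2
    exact hm.trans (Finset.le_sup (f := fun b : {x // x ∈ exPts (C.erase a.1)} =>
      w b.1 + gameM w ((C.erase a.1).erase b.1)) (Finset.mem_attach _ ⟨b, hb⟩))

lemma le_gameM_map {ι : Type} {pt : Option (ι × Fin 6) ↪ ℝ × ℝ}
    {S : Finset (Option (ι × Fin 6))} {w : ℝ × ℝ → ℕ} {m : ℕ} (hS : 2 ≤ S.card)
    (h : ∀ a ∈ S, pt a ∈ exPts (S.map pt) → ∃ b ∈ S.erase a,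
      pt b ∈ exPts ((S.erase a).map pt) ∧
        m ≤ w (pt b) + gameM w (((S.erase a).erase b).map pt)) :
    m ≤ gameM w (S.map pt) := by
  refine le_gameM (by rwa [Finset.card_map]) fun x hx => ?_
  obtain ⟨a, ha, rfl⟩ := Finset.mem_map.1 (Finset.mem_filter.1 hx).1
  obtain ⟨b, hb, hbx, hm⟩ := h a ha hx
  exact ⟨pt b, by rwa [← Finset.map_erase], by rwa [← Finset.map_erase, ← Finset.map_erase]⟩

/-- A cake made of spikes: `pt none` is a central point, and `pt (some (i, 0)), …,
pt (some (i, 5))` are the points of the spike `i`, from the tip inwards. The spikes are arranged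
around the centre, `L a i` meaning that the spike `a` lies to the left of the spike `i`. -/
structure IsSpikedCake {ι : Type} [Fintype ι] (pt : Option (ι × Fin 6) ↪ ℝ × ℝ)
    (L : ι → ι → Prop) (k : ℕ) : Prop where
  irrefl : ∀ i, ¬ L i i
  asymm : ∀ a b, L a b → ¬ L b a
  total : ∀ a b, a ≠ b → L a b ∨ L b a
  not_cycle_out : ∀ i a b c, L i a → L i b → L i c → L a b → L b c → ¬ L c a
  not_cycle_in : ∀ i a b c, L a i → L b i → L c i → L a b → L b c → ¬ L c a
  card_out_le : ∀ i, (Finset.univ.filter (L i)).card ≤ k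
  within : ∀ i j j' j'', j < j' → j' < j'' →
    orientDet (pt (some (i, j))) (pt (some (i, j'))) (pt (some (i, j''))) < 0
  left : ∀ a i j j' l, L a i → j < j' →
    0 < orientDet (pt (some (i, j))) (pt (some (i, j'))) (pt (some (a, l)))
  right : ∀ i b j j' l, L i b → j < j' →
    orientDet (pt (some (i, j))) (pt (some (i, j'))) (pt (some (b, l))) < 0
  center : ∀ i j j', j < j' → 0 < orientDet (pt (some (i, j))) (pt (some (i, j'))) (pt none)
  three : ∀ a i b j l m, L a i → L i b →
    0 < orientDet (pt (some (i, j))) (pt (some (b, l))) (pt (some (a, m)))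
  center_two : ∀ a i l j, L a i →
    0 < orientDet (pt none) (pt (some (a, l))) (pt (some (i, j)))
  tip : ∀ i j, ∃ c d : ℝ, ∀ q, q ≠ some (i, j) → (∀ t < j, q ≠ some (i, t)) →
    c * (pt q).1 + d * (pt q).2 < c * (pt (some (i, j))).1 + d * (pt (some (i, j))).2

namespace IsSpikedCake

variable {ι : Type} [Fintype ι] {pt : Option (ι × Fin 6) ↪ ℝ × ℝ} {L : ι → ι → Prop} {k : ℕ}
  {S : Finset (Option (ι × Fin 6))}

lemma notMem_exPts_of_left_of_right (H : IsSpikedCake pt L k) {a i b : ι} {t j l m : Fin 6}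
    (hai : L a i) (hib : L i b) (ha : some (a, l) ∈ S) (hb : some (b, m) ∈ S)
    (ht : some (i, t) ∈ S) (htj : t < j) : pt (some (i, j)) ∉ exPts (S.map pt) := by
  refine notMem_exPts_of_triangle (Finset.mem_map_of_mem pt ht) (Finset.mem_map_of_mem pt hb)
    (Finset.mem_map_of_mem pt ha) ?_ ?_ ?_
  · rw [orientDet_swap_right, neg_pos]
    exact H.right i b t j m hib htj
  · rw [orientDet_rotate]
    exact H.three a i b j m l hai hib
  · rw [← orientDet_rotate]
    exact H.left a i t j l hai htj

lemma notMem_exPts_of_between (H : IsSpikedCake pt L k) {i : ι} {t j j' : Fin 6}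
    {y : Option (ι × Fin 6)} (hy : y ∈ S) (hy' : y = none ∨ ∃ a l, y = some (a, l) ∧ L a i)
    (ht : some (i, t) ∈ S) (hj' : some (i, j') ∈ S) (htj : t < j) (hjj' : j < j') :
    pt (some (i, j)) ∉ exPts (S.map pt) := by
  have key : ∀ t j, t < j → 0 < orientDet (pt (some (i, t))) (pt (some (i, j))) (pt y) := by
    intro t j htj
    rcases hy' with rfl | ⟨a, l, rfl, hL⟩
    · exact H.center i t j htj
    · exact H.left a i t j l hL htj
  refine notMem_exPts_of_triangle (Finset.mem_map_of_mem pt ht) (Finset.mem_map_of_mem pt hj')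
    (Finset.mem_map_of_mem pt hy) ?_ ?_ ?_
  · rw [orientDet_swap_right, neg_pos]
    exact H.within i t j j' htj hjj'
  · rw [orientDet_rotate]
    exact key j j' hjj'
  · rw [← orientDet_rotate]
    exact key t j htj

lemma none_notMem_exPts (H : IsSpikedCake pt L k) {a b c : ι} {l m n : Fin 6}
    (hab : L a b) (hbc : L b c) (hca : L c a) (ha : some (a, l) ∈ S) (hb : some (b, m) ∈ S)
    (hc : some (c, n) ∈ S) : pt none ∉ exPts (S.map pt) := by
  refine notMem_exPts_of_triangle (Finset.mem_map_of_mem pt ha) (Finset.mem_map_of_mem pt hb)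
    (Finset.mem_map_of_mem pt hc) ?_ ?_ ?_ <;> rw [orientDet_rotate]
  exacts [H.center_two _ _ _ _ hab, H.center_two _ _ _ _ hbc, H.center_two _ _ _ _ hca]

lemma tip_mem_exPts (H : IsSpikedCake pt L k) {i : ι} {j : Fin 6} (hj : some (i, j) ∈ S)
    (ht : ∀ t < j, some (i, t) ∉ S) : pt (some (i, j)) ∈ exPts (S.map pt) := by
  obtain ⟨c, d, h⟩ := H.tip i j
  refine mem_exPts_of_lt (pt (some (i, j))) c d (Finset.mem_map_of_mem pt hj) le_rfl ?_
  intro y hy hyx _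
  obtain ⟨q, hq, rfl⟩ := Finset.mem_map.1 hy
  exact h q (fun e => hyx (e ▸ rfl)) fun t htj e => ht t htj (e ▸ hq)

lemma mem_exPts_of_source (H : IsSpikedCake pt L k) {i : ι} {j : Fin 6} (hz : none ∉ S)
    (hj : some (i, j) ∈ S) (hi : ∀ b l, some (b, l) ∈ S → b ≠ i → L i b) :
    pt (some (i, j)) ∈ exPts (S.map pt) := by
  by_cases h5 : j = 5
  · subst h5
    refine mem_exPts_of_orientDet_pos (pt (some (i, 4))) (Finset.mem_map_of_mem pt hj) ?_
    intro y hy hyx hyq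
    obtain ⟨q, hq, rfl⟩ := Finset.mem_map.1 hy
    rw [orientDet_swap, neg_pos]
    rcases q with _ | ⟨b, l⟩
    · exact absurd hq hz
    by_cases hb : b = i
    · subst hb
      have h4 : l < 4 := by
        have h1 : l ≠ 5 := fun e => hyx (by rw [e])
        have h2 : l ≠ 4 := fun e => hyq (by rw [e])
        omega
      rw [orientDet_rotate]
      exact H.within b l 4 5 h4 (by decide)
    · exact H.right i b 4 5 l (hi b l hq hb) (by decide)
  · have hlt : j < j + 1 := by omega
    refine mem_exPts_of_orientDet_neg (pt (some (i, j + 1))) (Finset.mem_map_of_mem pt hj) ?_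
    intro y hy hyx hyq
    obtain ⟨q, hq, rfl⟩ := Finset.mem_map.1 hy
    rcases q with _ | ⟨b, l⟩
    · exact absurd hq hz
    by_cases hb : b = i
    · subst hb
      have h1 : l ≠ j := fun e => hyx (by rw [e])
      have h2 : l ≠ j + 1 := fun e => hyq (by rw [e])
      rcases lt_or_gt_of_ne h1 with h | h
      · rw [orientDet_rotate]
        exact H.within b l j (j + 1) h hlt
      · exact H.within b j (j + 1) l hlt (by omega)
    · exact H.right i b j (j + 1) l (hi b l hq hb) hlt

lemma three_mem_exPts (H : IsSpikedCake pt L k) {i : ι} (hz : none ∉ S)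
    (h3 : some (i, 3) ∈ S) (h4 : some (i, 4) ∉ S) (h5 : some (i, 5) ∉ S)
    (hi : ∀ a l, some (a, l) ∈ S → a ≠ i → L a i) : pt (some (i, 3)) ∈ exPts (S.map pt) := by
  refine mem_exPts_of_orientDet_neg (pt (some (i, 0))) (Finset.mem_map_of_mem pt h3) ?_
  intro y hy hyx hyq
  obtain ⟨q, hq, rfl⟩ := Finset.mem_map.1 hy
  rw [orientDet_swap, neg_lt_zero]
  rcases q with _ | ⟨a, l⟩
  · exact absurd hq hz
  by_cases ha : a = i
  · subst ha
    have h0 : l ≠ 0 := fun e => hyq (by rw [e])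
    have h3' : l ≠ 3 := fun e => hyx (by rw [e])
    have h4' : l ≠ 4 := fun e => h4 (e ▸ hq)
    have h5' : l ≠ 5 := fun e => h5 (e ▸ hq)
    rw [orientDet_swap_right, neg_pos]
    exact H.within a 0 l 3 (by omega) (by omega)
  · exact H.left a i 0 3 l (hi a l hq ha) (by decide)

lemma none_mem_exPts (H : IsSpikedCake pt L k) (hz : none ∈ S) (i : ι)
    (hi : ∀ b l, some (b, l) ∈ S → b ≠ i → L i b) : pt none ∈ exPts (S.map pt) := by
  refine mem_exPts_of_orientDet_pos (pt (some (i, 0))) (Finset.mem_map_of_mem pt hz) ?_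
  intro y hy hyx hyq
  obtain ⟨q, hq, rfl⟩ := Finset.mem_map.1 hy
  rcases q with _ | ⟨b, l⟩
  · exact absurd rfl hyx
  by_cases hb : b = i
  · subst hb
    have h0 : l ≠ 0 := fun e => hyq (by rw [e])
    rw [← orientDet_rotate]
    exact H.center b 0 l (by omega)
  · exact H.center_two i b 0 l (hi b l hq hb)

end IsSpikedCake

/-- The spike `i` still has a point in `S`. -/
def Occupied {ι : Type} (S : Finset (Option (ι × Fin 6))) (i : ι) : Prop :=
  ∃ j, some (i, j) ∈ S

/-- Both red points of the spike `i` are still in `S`. -/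
def HasTwins {ι : Type} (S : Finset (Option (ι × Fin 6))) (i : ι) : Prop :=
  some (i, 1) ∈ S ∧ some (i, 3) ∈ S

/-- If the spike `i` has both its red points and a spike to its left, then the red points are
protected by green points on both sides. -/
def GuardedAt {ι : Type} (L : ι → ι → Prop) (S : Finset (Option (ι × Fin 6))) (i : ι) : Prop :=
  HasTwins S i → (∃ a, Occupied S a ∧ L a i) →
    some (i, 0) ∈ S ∧ (some (i, 4) ∈ S ∨ some (i, 5) ∈ S)

/-- The occupied spikes contain no cyclic triple. -/
def AcyclicSpikes {ι : Type} (L : ι → ι → Prop) (S : Finset (Option (ι × Fin 6))) : Prop :=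
  ∀ a b c, Occupied S a → Occupied S b → Occupied S c → L a b → L b c → ¬ L c a

/-- The centre is present, and from each spike an even number of points has been removed, starting
from the tip. -/
def IsPaired {ι : Type} (S : Finset (Option (ι × Fin 6))) : Prop :=
  none ∈ S ∧ ∀ i, ∃ m : ℕ, ∀ j : Fin 6, some (i, j) ∈ S ↔ 2 * m ≤ j

/-- The number of spikes having both their red points in `S`. -/
def twinCount {ι : Type} [Fintype ι] (S : Finset (Option (ι × Fin 6))) : ℕ :=
  (Finset.univ.filter (HasTwins S)).card

/-- The red points are those at positions `1` and `3` of a spike. -/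
def IsRed {ι : Type} (q : Option (ι × Fin 6)) : Prop :=
  ∃ i, q = some (i, 1) ∨ q = some (i, 3)

section Counting

variable {ι : Type} {S S' : Finset (Option (ι × Fin 6))} {L : ι → ι → Prop}

lemma Occupied.mono (h : S ⊆ S') {i : ι} (hi : Occupied S i) : Occupied S' i :=
  hi.imp fun _ hj => h hj

lemma HasTwins.mono (h : S ⊆ S') {i : ι} (hi : HasTwins S i) : HasTwins S' i :=
  ⟨h hi.1, h hi.2⟩

lemma AcyclicSpikes.mono (h : S ⊆ S') (hS : AcyclicSpikes L S') : AcyclicSpikes L S :=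
  fun a b c ha hb hc => hS a b c (ha.mono h) (hb.mono h) (hc.mono h)

lemma HasTwins.erase {i i' : ι} {j : Fin 6} (h : HasTwins S i')
    (hij : i' ≠ i ∨ j ≠ 1 ∧ j ≠ 3) : HasTwins (S.erase (some (i, j))) i' := by
  refine ⟨Finset.mem_erase.2 ⟨?_, h.1⟩, Finset.mem_erase.2 ⟨?_, h.2⟩⟩ <;>
  · simp only [ne_eq, Option.some.injEq, Prod.mk.injEq]
    rintro ⟨rfl, rfl⟩
    simp at hij

lemma GuardedAt.erase {i i' : ι} {j : Fin 6} (h : GuardedAt L S i') (hi : i' ≠ i) :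
    GuardedAt L (S.erase (some (i, j))) i' := by
  rintro ht ⟨a, ha, hL⟩
  have key := h (ht.mono (Finset.erase_subset _ _)) ⟨a, ha.mono (Finset.erase_subset _ _), hL⟩
  simpa [hi] using key

lemma GuardedAt.of_not_hasTwins {i : ι} (h : ¬ HasTwins S i) : GuardedAt L S i :=
  fun ht => absurd ht h

lemma guardedAt_erase_of_not_hasTwins {i : ι} {j : Fin 6} (h : ∀ i', i' ≠ i → GuardedAt L S i')
    (hi : ¬ HasTwins (S.erase (some (i, j))) i) (i' : ι) :
    GuardedAt L (S.erase (some (i, j))) i' := by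
  by_cases hii : i' = i
  · subst hii
    exact .of_not_hasTwins hi
  · exact (h i' hii).erase hii

lemma card_isRed_le_erase_add (q : Option (ι × Fin 6)) :
    (S.filter IsRed).card ≤ ((S.erase q).filter IsRed).card + (if IsRed q then 1 else 0) := by
  rw [Finset.filter_erase]
  split_ifs with h
  · have := Finset.pred_card_le_card_erase (s := S.filter IsRed) (a := q)
    omega
  · rw [Finset.erase_eq_of_notMem fun hq => h (Finset.mem_filter.1 hq).2]
    omega

variable [Fintype ι]

lemma twinCount_le_of_imp (h : ∀ i, HasTwins S i → HasTwins S' i) :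
    twinCount S ≤ twinCount S' :=
  Finset.card_le_card fun i hi => by
    simp only [Finset.mem_filter, Finset.mem_univ, true_and] at hi ⊢
    exact h i hi

lemma twinCount_le_erase_add_one (i : ι) (j : Fin 6) :
    twinCount S ≤ twinCount (S.erase (some (i, j))) + 1 := by
  refine le_trans (Finset.card_le_card (t := insert i
    (Finset.univ.filter (HasTwins (S.erase (some (i, j)))))) fun i' hi' => ?_)
    (Finset.card_insert_le _ _)
  simp only [Finset.mem_filter, Finset.mem_univ, true_and, Finset.mem_insert] at hi' ⊢
  by_cases h : i' = i
  · exact Or.inl h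
  · exact Or.inr (hi'.erase (Or.inl h))

lemma twinCount_le_erase_of_not_hasTwins {i : ι} {j : Fin 6} (h : ¬ HasTwins S i) :
    twinCount S ≤ twinCount (S.erase (some (i, j))) :=
  twinCount_le_of_imp fun _ hi' => hi'.erase (Or.inl fun e => h (e ▸ hi'))

lemma twinCount_eq_zero_of_card_le_one (h : S.card ≤ 1) : twinCount S = 0 := by
  refine Finset.card_eq_zero.2 (Finset.filter_eq_empty_iff.2 fun i _ hi => ?_)
  have := Finset.card_le_one.1 h _ hi.1 _ hi.2
  simp at this

lemma card_isRed_le :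
    (S.filter IsRed).card ≤ twinCount S + (Finset.univ.filter (Occupied S)).card := by
  set A := Finset.univ.filter fun i : ι => some (i, (1 : Fin 6)) ∈ S
  set B := Finset.univ.filter fun i : ι => some (i, (3 : Fin 6)) ∈ S
  have h1 : S.filter IsRed ⊆ A.image (fun i => some (i, 1)) ∪ B.image (fun i => some (i, 3)) := by
    intro q hq
    obtain ⟨hqS, i, rfl | rfl⟩ := Finset.mem_filter.1 hq <;> simp [A, B, hqS]
  have h2 : A ∩ B ⊆ Finset.univ.filter (HasTwins S) := by
    intro i hi
    simpa [A, B, HasTwins] using hi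
  have h3 : A ∪ B ⊆ Finset.univ.filter (Occupied S) := by
    intro i hi
    simp only [A, B, Finset.mem_union, Finset.mem_filter, Finset.mem_univ, true_and] at hi ⊢
    exact hi.elim (fun h => ⟨_, h⟩) (fun h => ⟨_, h⟩)
  calc (S.filter IsRed).card ≤ _ := Finset.card_le_card h1
    _ ≤ _ := Finset.card_union_le _ _
    _ ≤ A.card + B.card := add_le_add Finset.card_image_le Finset.card_image_le
    _ = (A ∪ B).card + (A ∩ B).card := (Finset.card_union_add_card_inter A B).symm
    _ ≤ _ := by
      rw [add_comm]
      exact add_le_add (Finset.card_le_card h2) (Finset.card_le_card h3)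

end Counting

namespace IsSpikedCake

variable {ι : Type} [Fintype ι] {pt : Option (ι × Fin 6) ↪ ℝ × ℝ} {L : ι → ι → Prop} {k : ℕ}
  {S : Finset (Option (ι × Fin 6))} {w : ℝ × ℝ → ℕ}

/-- The left-most occupied spike. -/
lemma exists_source (H : IsSpikedCake pt L k) (hS : AcyclicSpikes L S)
    (hne : ∃ i, Occupied S i) : ∃ i, Occupied S i ∧ ∀ b l, some (b, l) ∈ S → b ≠ i → L i b := by
  obtain ⟨i₀, hi₀⟩ := hne
  obtain ⟨i, hi, hmax⟩ := Finset.exists_max_image (Finset.univ.filter (Occupied S))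
    (fun i => (Finset.univ.filter fun b => Occupied S b ∧ L i b).card)
    ⟨i₀, by simpa using hi₀⟩
  simp only [Finset.mem_filter, Finset.mem_univ, true_and] at hi hmax
  refine ⟨i, hi, fun b l hb hbi => (H.total i b hbi.symm).resolve_right fun hL => ?_⟩
  refine absurd (hmax b ⟨l, hb⟩) (not_le.2 (Finset.card_lt_card ?_))
  refine Finset.ssubset_iff_of_subset (fun c hc => ?_) |>.2 ⟨i, ?_, ?_⟩
  · simp only [Finset.mem_filter, Finset.mem_univ, true_and] at hc ⊢
    refine ⟨hc.1, (H.total b c ?_).resolve_right fun hcb => ?_⟩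
    · rintro rfl
      exact H.asymm _ _ hL hc.2
    · exact hS i c b hi hc.1 ⟨l, hb⟩ hc.2 hcb hL
  · simp [hi, hL]
  · simp [H.irrefl]

lemma card_isRed_le_of_acyclicSpikes (H : IsSpikedCake pt L k) (hS : AcyclicSpikes L S)
    (hne : ∃ i, Occupied S i) : (S.filter IsRed).card ≤ twinCount S + (k + 1) := by
  obtain ⟨i, -, hi⟩ := H.exists_source hS hne
  refine card_isRed_le.trans (Nat.add_le_add_left ?_ _)
  refine (Finset.card_le_card (t := insert i (Finset.univ.filter (L i))) fun b hb => ?_).trans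
    ((Finset.card_insert_le _ _).trans (Nat.succ_le_succ (H.card_out_le i)))
  simp only [Finset.mem_filter, Finset.mem_univ, true_and, Finset.mem_insert] at hb ⊢
  obtain ⟨l, hl⟩ := hb
  exact or_iff_not_imp_left.2 (hi b l hl)

/-- Bob's good answer in a guarded acyclic position, given that smaller such positions are
worth at least their number of twins. -/
lemma exists_reply (H : IsSpikedCake pt L k) (hw : ∀ i, w (pt (some (i, 1))) = 1)
    (IH : ∀ S' ⊂ S, none ∉ S' → AcyclicSpikes L S' → (∀ i, GuardedAt L S' i) →
      twinCount S' ≤ gameM w (S'.map pt))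
    (hz : none ∉ S) (hac : AcyclicSpikes L S) (hg : ∀ i, GuardedAt L S i)
    (hne : S.Nonempty) :
    ∃ b ∈ S, pt b ∈ exPts (S.map pt) ∧
      twinCount S ≤ w (pt b) + gameM w ((S.erase b).map pt) := by
  have hocc : ∃ i, Occupied S i := by
    obtain ⟨_ | ⟨i, j⟩, hq⟩ := hne
    exacts [absurd hq hz, ⟨i, j, hq⟩]
  obtain ⟨i, ⟨j, hj⟩, hi⟩ := H.exists_source hac hocc
  have key : ∀ j, some (i, j) ∈ S → ¬ HasTwins (S.erase (some (i, j))) i →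
      twinCount (S.erase (some (i, j))) ≤ gameM w ((S.erase (some (i, j))).map pt) :=
    fun j hj hij => IH _ (Finset.erase_ssubset hj) (fun h => hz (Finset.mem_of_mem_erase h))
      (hac.mono (Finset.erase_subset _ _))
      (guardedAt_erase_of_not_hasTwins (fun i' _ => hg i') hij)
  by_cases ht : HasTwins S i
  · refine ⟨some (i, 1), ht.1, H.mem_exPts_of_source hz ht.1 hi, ?_⟩
    have h1 := key 1 ht.1 fun h => Finset.notMem_erase _ _ h.1
    have h2 := twinCount_le_erase_add_one (S := S) i 1
    rw [hw]
    omega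
  · refine ⟨some (i, j), hj, H.mem_exPts_of_source hz hj hi, ?_⟩
    have h1 := key j hj fun h => ht (h.mono (Finset.erase_subset _ _))
    have h2 := twinCount_le_erase_of_not_hasTwins (j := j) ht
    omega

/-- In a guarded acyclic position without centre, Bob gets a red point of each pair of twins. -/
lemma twinCount_le_gameM (H : IsSpikedCake pt L k) (hw : ∀ i, w (pt (some (i, 1))) = 1)
    (hw' : ∀ i, w (pt (some (i, 3))) = 1) (S : Finset (Option (ι × Fin 6))) (hz : none ∉ S)
    (hac : AcyclicSpikes L S) (hg : ∀ i, GuardedAt L S i) :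
    twinCount S ≤ gameM w (S.map pt) := by
  induction S using Finset.strongInduction with
  | H S IH =>
  rcases Nat.lt_or_ge 1 S.card with hcard | hcard
  swap
  · simp [twinCount_eq_zero_of_card_le_one hcard]
  refine le_gameM_map hcard fun a ha hax => ?_
  rcases a with _ | ⟨i, j⟩
  · exact absurd ha hz
  set S₁ := S.erase (some (i, j))
  have hsub : S₁ ⊆ S := Finset.erase_subset _ _
  have hz₁ : none ∉ S₁ := fun h => hz (hsub h)
  have hac₁ : AcyclicSpikes L S₁ := hac.mono hsub
  have reply : ∀ j', some (i, j') ∈ S₁ → ¬ HasTwins (S₁.erase (some (i, j'))) i →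
      twinCount (S₁.erase (some (i, j'))) ≤ gameM w ((S₁.erase (some (i, j'))).map pt) := by
    intro j' hj' hij
    refine IH _ ((Finset.erase_ssubset hj').trans_subset hsub)
      (fun h => hz₁ (Finset.mem_of_mem_erase h))
      (hac₁.mono (Finset.erase_subset _ _)) (guardedAt_erase_of_not_hasTwins (fun i' hi' => ?_) hij)
    exact (hg i').erase hi'
  by_cases hred : HasTwins S i ∧ (j = 1 ∨ j = 3)
  · obtain ⟨ht, hj⟩ := hred
    have hsrc : ∀ b l, some (b, l) ∈ S₁ → b ≠ i → L i b := by
      intro b l hb hbi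
      refine (H.total i b hbi.symm).resolve_right fun hL => ?_
      have hb := hsub hb
      obtain ⟨h0, h4 | h5⟩ := hg i ht ⟨b, ⟨l, hb⟩, hL⟩
      · exact H.notMem_exPts_of_between hb (Or.inr ⟨b, l, rfl, hL⟩) h0 h4
          (by rcases hj with rfl | rfl <;> decide) (by rcases hj with rfl | rfl <;> decide) hax
      · exact H.notMem_exPts_of_between hb (Or.inr ⟨b, l, rfl, hL⟩) h0 h5
          (by rcases hj with rfl | rfl <;> decide) (by rcases hj with rfl | rfl <;> decide) hax
    have hnt : ¬ HasTwins S₁ i := by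
      rcases hj with rfl | rfl
      · exact fun h => Finset.notMem_erase _ _ h.1
      · exact fun h => Finset.notMem_erase _ _ h.2
    have h1 : twinCount S ≤ twinCount S₁ + 1 := twinCount_le_erase_add_one i j
    obtain ⟨j', hj', hwj⟩ : ∃ j', some (i, j') ∈ S₁ ∧ w (pt (some (i, j'))) = 1 := by
      rcases hj with rfl | rfl
      · exact ⟨3, Finset.mem_erase.2 ⟨by simp, ht.2⟩, hw' i⟩
      · exact ⟨1, Finset.mem_erase.2 ⟨by simp, ht.1⟩, hw i⟩
    refine ⟨some (i, j'), hj', H.mem_exPts_of_source hz₁ hj' hsrc, ?_⟩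
    have h2 := twinCount_le_erase_of_not_hasTwins (j := j') hnt
    have h3 := reply j' hj' fun h => hnt (h.mono (Finset.erase_subset _ _))
    rw [hwj]
    omega
  · have hT : twinCount S ≤ twinCount S₁ := by
      refine twinCount_le_of_imp fun i' hi' => hi'.erase ?_
      by_cases hii : i' = i
      · subst hii
        exact Or.inr ⟨fun h => hred ⟨hi', Or.inl h⟩, fun h => hred ⟨hi', Or.inr h⟩⟩
      · exact Or.inl hii
    by_cases hg₁ : ∀ i, GuardedAt L S₁ i
    · obtain ⟨b, hb, hbx, hm⟩ := H.exists_reply hw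
        (fun S' hS' => IH S' (hS'.trans_subset hsub)) hz₁ hac₁ hg₁
        (by rw [← Finset.card_pos, Finset.card_erase_of_mem ha]; omega)
      exact ⟨b, hb, hbx, hT.trans hm⟩
    · obtain ⟨i', hi'⟩ := not_forall.1 hg₁
      obtain rfl : i' = i := by
        by_contra hii
        exact hi' ((hg i').erase hii)
      unfold GuardedAt at hi'
      push Not at hi'
      obtain ⟨ht₁, ⟨a, ⟨l, hal⟩, hL⟩, hbad⟩ := hi'
      have ht := ht₁.mono hsub
      have hal := hsub hal
      obtain ⟨h0, h45⟩ := hg i' ht ⟨a, ⟨l, hal⟩, hL⟩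
      by_cases hj0 : j = 0
      · subst hj0
        refine ⟨some (i', 1), ht₁.1, H.tip_mem_exPts ht₁.1 fun t ht => ?_, ?_⟩
        · obtain rfl : t = 0 := by omega
          exact Finset.notMem_erase _ _
        · have h1 := reply 1 ht₁.1 fun h => Finset.notMem_erase _ _ h.1
          have h2 := twinCount_le_erase_add_one (S := S₁) i' 1
          rw [hw]
          omega
      · obtain ⟨h4, h5⟩ := hbad (Finset.mem_erase.2 ⟨by simpa using Ne.symm hj0, h0⟩)
        refine ⟨some (i', 3), ht₁.2, H.three_mem_exPts hz₁ ht₁.2 h4 h5 fun b m hb hbi => ?_, ?_⟩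
        · refine (H.total b i' hbi).resolve_right fun hib => ?_
          exact H.notMem_exPts_of_left_of_right hL hib hal (hsub hb) h0 (by omega) hax
        · have h1 := reply 3 ht₁.2 fun h => Finset.notMem_erase _ _ h.2
          have h2 := twinCount_le_erase_add_one (S := S₁) i' 3
          rw [hw']
          omega

/-- From a paired position Bob gets all but at most `k + 1` of the red points. -/
lemma card_isRed_le_gameM_add (H : IsSpikedCake pt L k) (hw : ∀ i, w (pt (some (i, 1))) = 1)
    (hw' : ∀ i, w (pt (some (i, 3))) = 1) (S : Finset (Option (ι × Fin 6))) (hS : IsPaired S) :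
    (S.filter IsRed).card ≤ gameM w (S.map pt) + (k + 1) := by
  induction S using Finset.strongInduction with
  | H S IH =>
  rcases Nat.lt_or_ge 1 S.card with hcard | hcard
  swap
  · rw [Finset.card_eq_zero.2]
    · omega
    · refine Finset.filter_eq_empty_iff.2 fun q hq hr => ?_
      obtain rfl := Finset.card_le_one.1 hcard _ hq _ hS.1
      simp [IsRed] at hr
  have hall : ∀ i, HasTwins S i → ∀ j, some (i, j) ∈ S := by
    intro i hi j
    obtain ⟨m, hm⟩ := hS.2 i
    have := (hm 1).1 hi.1
    rw [hm]
    simp at this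
    omega
  have hocc : ∃ i, Occupied S i := by
    obtain ⟨q, hq, hqn⟩ := Finset.exists_mem_ne hcard none
    rcases q with _ | ⟨i, j⟩
    exacts [absurd rfl hqn, ⟨i, j, hq⟩]
  rw [← Nat.sub_le_iff_le_add]
  refine le_gameM_map hcard fun a ha hax => ?_
  rcases a with _ | ⟨i, j⟩
  · have hac : AcyclicSpikes L S := fun a b c ⟨_, ha⟩ ⟨_, hb⟩ ⟨_, hc⟩ hab hbc hca =>
      H.none_notMem_exPts hab hbc hca ha hb hc hax
    have h1 := H.card_isRed_le_of_acyclicSpikes hac hocc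
    have h2 : twinCount S ≤ twinCount (S.erase none) :=
      twinCount_le_of_imp fun i hi => by simpa [HasTwins] using hi
    obtain ⟨b, hb, hbx, hm⟩ := H.exists_reply (S := S.erase none) hw
      (fun S' _ => H.twinCount_le_gameM hw hw' S') (Finset.notMem_erase _ _)
      (hac.mono (Finset.erase_subset _ _))
      (fun i hi _ => by
        have := hall i (hi.mono (Finset.erase_subset _ _))
        simp [this])
      (by rw [← Finset.card_pos, Finset.card_erase_of_mem ha]; omega)
    exact ⟨b, hb, hbx, by omega⟩
  · obtain ⟨m, hm⟩ := hS.2 i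
    have hmj := (hm j).1 ha
    rcases Nat.eq_or_lt_of_le hmj with hmj | hmj
    · have hj' : ((j + 1 : Fin 6) : ℕ) = 2 * m + 1 := by omega
      have hb : some (i, j + 1) ∈ S.erase (some (i, j)) := by
        refine Finset.mem_erase.2 ⟨by simp, (hm _).2 (by omega)⟩
      refine ⟨_, hb, H.tip_mem_exPts hb fun t ht => ?_, ?_⟩
      · have : t ≠ j → some (i, t) ∉ S := fun htj => by
          rw [hm]
          omega
        simpa using this
      · have hsub : (S.erase (some (i, j))).erase (some (i, j + 1)) ⊂ S :=
          (Finset.erase_ssubset hb).trans_subset (Finset.erase_subset _ _)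
        have h1 := IH _ hsub ⟨by simpa using hS.1, fun i' => ?_⟩
        · have h2 := card_isRed_le_erase_add (S := S) (some (i, j))
          have h3 := card_isRed_le_erase_add (S := S.erase (some (i, j))) (some (i, j + 1))
          rw [if_neg] at h2
          · have h4 : (if IsRed (some (i, j + 1)) then 1 else 0) ≤ w (pt (some (i, j + 1))) := by
              split_ifs with hr
              · obtain ⟨i', hr | hr⟩ := hr
                · rw [hr, hw]
                · rw [hr, hw']
              · exact Nat.zero_le _
            omega
          · simp only [IsRed, Option.some.injEq, Prod.mk.injEq]
            rintro ⟨_, ⟨-, rfl⟩ | ⟨-, rfl⟩⟩ <;> omega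
        · by_cases hii : i' = i
          · subst hii
            refine ⟨m + 1, fun t => ?_⟩
            simp only [Finset.mem_erase, ne_eq, Option.some.injEq, Prod.mk.injEq, true_and, hm]
            omega
          · obtain ⟨m', hm'⟩ := hS.2 i'
            exact ⟨m', fun t => by simp [hii, hm']⟩
    · have htop : some (i, (⟨2 * m, by omega⟩ : Fin 6)) ∈ S := (hm _).2 le_rfl
      have hlt : (⟨2 * m, by omega⟩ : Fin 6) < j := Fin.lt_def.2 hmj
      have hj5 : j = 5 := by
        by_contra hj
        exact H.notMem_exPts_of_between hS.1 (Or.inl rfl) htop ((hm 5).2 (by simp; omega)) hlt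
          (by omega) hax
      subst hj5
      have hside : ∀ a b, Occupied S a → Occupied S b → L a i → ¬ L i b :=
        fun a b ⟨_, ha⟩ ⟨_, hb⟩ hai hib =>
          H.notMem_exPts_of_left_of_right hai hib ha hb htop hlt hax
      have hac : AcyclicSpikes L S := by
        intro a b c ha hb hc hab hbc hca
        by_cases hia : i = a
        · subst hia
          exact hside c b hc hb hca hab
        by_cases hib : i = b
        · subst hib
          exact hside a c ha hc hab hbc
        by_cases hic : i = c
        · subst hic
          exact hside b a hb ha hbc hca
        have hnl : ∀ x y, Occupied S x → Occupied S y → i ≠ y → L x i → L y i :=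
          fun x y hx hy hiy hxi => (H.total i y hiy).resolve_left (hside x y hx hy hxi)
        by_cases hl : L a i ∨ L b i ∨ L c i
        · have : ∃ x, Occupied S x ∧ L x i := by
            rcases hl with h | h | h
            exacts [⟨a, ha, h⟩, ⟨b, hb, h⟩, ⟨c, hc, h⟩]
          obtain ⟨x, hx, hxi⟩ := this
          exact H.not_cycle_in i a b c (hnl x a hx ha hia hxi) (hnl x b hx hb hib hxi)
            (hnl x c hx hc hic hxi) hab hbc hca
        · push Not at hl
          exact H.not_cycle_out i a b c ((H.total i a hia).resolve_right hl.1)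
            ((H.total i b hib).resolve_right hl.2.1) ((H.total i c hic).resolve_right hl.2.2)
            hab hbc hca
      obtain ⟨s, -, hs⟩ := H.exists_source hac hocc
      have hnone : none ∈ S.erase (some (i, 5)) := by simpa using hS.1
      refine ⟨none, hnone, H.none_mem_exPts hnone s fun b l hb =>
        hs b l (Finset.mem_of_mem_erase hb), ?_⟩
      have hsub : (S.erase (some (i, 5))).erase none ⊆ S :=
        (Finset.erase_subset _ _).trans (Finset.erase_subset _ _)
      have h1 := H.card_isRed_le_of_acyclicSpikes hac hocc
      have h2 : twinCount S ≤ twinCount ((S.erase (some (i, 5))).erase none) :=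
        twinCount_le_of_imp fun i hi => by simpa [HasTwins] using hi
      have h3 := H.twinCount_le_gameM hw hw' _ (Finset.notMem_erase _ _) (hac.mono hsub)
        (fun i' hi _ => by
          have := hall i' (hi.mono hsub)
          simp [this])
      omega

end IsSpikedCake

/-- The index-wise form of general position for a spiked cake. -/
lemma IsSpikedCake.orientDet_ne_zero {ι : Type} [Fintype ι] {pt : Option (ι × Fin 6) ↪ ℝ × ℝ}
    {L : ι → ι → Prop} {k : ℕ} (H : IsSpikedCake pt L k) {x y z : Option (ι × Fin 6)}
    (hxy : x ≠ y) (hxz : x ≠ z) (hyz : y ≠ z) : orientDet (pt x) (pt y) (pt z) ≠ 0 := by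
  have rot : ∀ {x y z}, orientDet (pt x) (pt y) (pt z) ≠ 0 →
      orientDet (pt y) (pt z) (pt x) ≠ 0 := fun h => by rwa [orientDet_rotate]
  have swap : ∀ {x y z}, orientDet (pt x) (pt y) (pt z) ≠ 0 →
      orientDet (pt y) (pt x) (pt z) ≠ 0 := fun h => by rwa [orientDet_swap, neg_ne_zero]
  have flip : ∀ {x y z}, orientDet (pt x) (pt y) (pt z) ≠ 0 →
      orientDet (pt x) (pt z) (pt y) ≠ 0 := fun h => by rwa [orientDet_swap_right, neg_ne_zero]
  have same : ∀ i j j' j'', j ≠ j' → j ≠ j'' → j' ≠ j'' →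
      orientDet (pt (some (i, j))) (pt (some (i, j'))) (pt (some (i, j''))) ≠ 0 := by
    intro i j j' j'' h1 h2 h3
    have key := fun a b c h h' => (H.within i a b c h h').ne
    rcases lt_or_gt_of_ne h1 with h1 | h1 <;> rcases lt_or_gt_of_ne h2 with h2 | h2 <;>
      rcases lt_or_gt_of_ne h3 with h3 | h3
    · exact key _ _ _ h1 h3
    · exact flip (key _ _ _ h2 h3)
    · omega
    · exact rot (key _ _ _ h2 h1)
    · exact swap (key _ _ _ h1 h2)
    · omega
    · exact rot (rot (key _ _ _ h3 h2))
    · exact swap (rot (key _ _ _ h3 h1))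
  have two : ∀ i j j' z, j ≠ j' → (∀ t, z ≠ some (i, t)) →
      orientDet (pt (some (i, j))) (pt (some (i, j'))) (pt z) ≠ 0 := by
    intro i j j' z hj hz
    have key : ∀ j j', j < j' →
        orientDet (pt (some (i, j))) (pt (some (i, j'))) (pt z) ≠ 0 := by
      intro j j' hj
      rcases z with _ | ⟨a, l⟩
      · exact (H.center i j j' hj).ne'
      · have hai : a ≠ i := by
          rintro rfl
          exact hz l rfl
        rcases H.total a i hai with h | h
        · exact (H.left a i j j' l h hj).ne'
        · exact (H.right i a j j' l h hj).ne
    rcases lt_or_gt_of_ne hj with hj | hj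
    · exact key _ _ hj
    · exact swap (key _ _ hj)
  have cen : ∀ a l b m, some (a, l) ≠ some (b, m) →
      orientDet (pt none) (pt (some (a, l))) (pt (some (b, m))) ≠ 0 := by
    intro a l b m h
    by_cases hab : a = b
    · subst hab
      exact rot (rot (two a l m none (fun e => h (by rw [e])) (by simp)))
    · rcases H.total a b hab with hL | hL
      · exact (H.center_two a b l m hL).ne'
      · exact flip (H.center_two b a m l hL).ne'
  rcases x with _ | ⟨a, l⟩
  · rcases y with _ | ⟨b, m⟩
    · exact absurd rfl hxy
    rcases z with _ | ⟨c, n⟩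
    · exact absurd rfl hxz
    exact cen b m c n hyz
  rcases y with _ | ⟨b, m⟩
  · rcases z with _ | ⟨c, n⟩
    · exact absurd rfl hyz
    exact swap (cen a l c n hxz)
  rcases z with _ | ⟨c, n⟩
  · exact rot (cen a l b m hxy)
  by_cases hab : a = b
  · subst hab
    by_cases hac : a = c
    · subst hac
      exact same a l m n (fun e => hxy (by rw [e])) (fun e => hxz (by rw [e]))
        (fun e => hyz (by rw [e]))
    · exact two a l m _ (fun e => hxy (by rw [e])) (by simp [Ne.symm hac])
  by_cases hac : a = c
  · subst hac
    exact flip (two a l n _ (fun e => hxz (by rw [e])) (by simp [Ne.symm hab]))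
  by_cases hbc : b = c
  · subst hbc
    exact rot (rot (two b m n _ (fun e => hyz (by rw [e])) (by simp [hab])))
  have key := fun a l i j b m h h' => (H.three a i b j m l h h').ne'
  rcases H.total a b hab with h1 | h1 <;> rcases H.total a c hac with h2 | h2 <;>
    rcases H.total b c hbc with h3 | h3
  · exact rot (rot (key _ _ _ _ _ _ h1 h3))
  · exact swap (rot (key _ _ _ _ _ _ h2 h3))
  · exact rot (rot (key _ _ _ _ _ _ h1 h3))
  · exact key _ _ _ _ _ _ h2 h1
  · exact flip (key _ _ _ _ _ _ h1 h2)
  · exact flip (key _ _ _ _ _ _ h1 h2)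
  · exact rot (key _ _ _ _ _ _ h3 h2)
  · exact swap (key _ _ _ _ _ _ h3 h1)

/-- The points of a spiked cake of sharpness `ε`, the tips being near the points `(u i, v i)` of the
unit circle. -/
def spikePoint {ι : Type} (u v : ι → ℝ) (ε : ℝ) : Option (ι × Fin 6) → ℝ × ℝ
  | none => (0, 0)
  | some (i, j) => ((1 - ε * (j : ℕ)) * u i - ε ^ 2 * (j : ℕ) ^ 2 * v i,
      (1 - ε * (j : ℕ)) * v i + ε ^ 2 * (j : ℕ) ^ 2 * u i)

section Coordinates

open Filter Topology

lemma eventually_pos_of_continuous {f : ℝ → ℝ} (hf : Continuous f) (h0 : 0 < f 0) :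
    ∀ᶠ ε in 𝓝[>] 0, 0 < f ε :=
  nhdsWithin_le_nhds ((isOpen_lt continuous_const hf).mem_nhds h0)

variable {ι : Type} {u v : ι → ℝ}

lemma continuous_spikePoint_fst (q : Option (ι × Fin 6)) :
    Continuous fun ε => (spikePoint u v ε q).1 := by
  rcases q with _ | ⟨i, j⟩
  · exact continuous_const
  · simp only [spikePoint]
    fun_prop

lemma continuous_spikePoint_snd (q : Option (ι × Fin 6)) :
    Continuous fun ε => (spikePoint u v ε q).2 := by
  rcases q with _ | ⟨i, j⟩
  · exact continuous_const
  · simp only [spikePoint]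
    fun_prop

lemma spikePoint_zero_some (i : ι) (j : Fin 6) : spikePoint u v 0 (some (i, j)) = (u i, v i) := by
  simp [spikePoint]

lemma eventually_orientDet_pos {x y z : Option (ι × Fin 6)}
    (h : 0 < orientDet (spikePoint u v 0 x) (spikePoint u v 0 y) (spikePoint u v 0 z)) :
    ∀ᶠ ε in 𝓝[>] 0,
      0 < orientDet (spikePoint u v ε x) (spikePoint u v ε y) (spikePoint u v ε z) := by
  refine eventually_pos_of_continuous
    (f := fun ε => orientDet (spikePoint u v ε x) (spikePoint u v ε y) (spikePoint u v ε z)) ?_ h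
  have h1 := continuous_spikePoint_fst (u := u) (v := v)
  have h2 := continuous_spikePoint_snd (u := u) (v := v)
  unfold orientDet
  exact (((h1 y).sub (h1 x)).mul ((h2 z).sub (h2 x))).sub
    (((h2 y).sub (h2 x)).mul ((h1 z).sub (h1 x)))

lemma cross_eq_add (huv : ∀ i, u i ^ 2 + v i ^ 2 = 1) (a i b : ι) :
    u a * v b - v a * u b =
    (u a * v i - v a * u i) * (u i * u b + v i * v b) +
      (u a * u i + v a * v i) * (u i * v b - v i * u b) := by
  linear_combination (-(u a * v b - v a * u b)) * huv i

lemma dot_lt_one (huv : ∀ i, u i ^ 2 + v i ^ 2 = 1) {a b : ι}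
    (h : u a * v b - v a * u b ≠ 0) : u a * u b + v a * v b < 1 := by
  have h1 := sq_pos_of_ne_zero h
  have h2 : (u a * u b + v a * v b) ^ 2 + (u a * v b - v a * u b) ^ 2 = 1 := by
    linear_combination (u b ^ 2 + v b ^ 2) * huv a + huv b
  nlinarith

lemma orientDet_spikePoint_within (huv : ∀ i, u i ^ 2 + v i ^ 2 = 1) {ε : ℝ} (i : ι)
    (j j' j'' : Fin 6) :
    orientDet (spikePoint u v ε (some (i, j))) (spikePoint u v ε (some (i, j')))
      (spikePoint u v ε (some (i, j''))) =
      -(ε ^ 3 * (((j' : ℕ) : ℝ) - (j : ℕ)) * (((j'' : ℕ) : ℝ) - (j : ℕ)) *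
        (((j'' : ℕ) : ℝ) - (j' : ℕ))) := by
  simp only [orientDet, spikePoint]
  linear_combination (-(ε ^ 3 * (((j' : ℕ) : ℝ) - (j : ℕ)) * (((j'' : ℕ) : ℝ) - (j : ℕ)) *
        (((j'' : ℕ) : ℝ) - (j' : ℕ)))) * huv i

lemma eventually_orientDet_center_pos (huv : ∀ i, u i ^ 2 + v i ^ 2 = 1) (i : ι) {j j' : Fin 6}
    (hj : j < j') : ∀ᶠ ε in 𝓝[>] 0, 0 < orientDet (spikePoint u v ε (some (i, j)))
      (spikePoint u v ε (some (i, j'))) (spikePoint u v ε none) := by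
  have hj' : ((j : ℕ) : ℝ) < (j' : ℕ) := by exact_mod_cast hj
  have hj0 : (0 : ℝ) ≤ (j : ℕ) := Nat.cast_nonneg _
  filter_upwards [self_mem_nhdsWithin, eventually_pos_of_continuous
    (f := fun ε => ((j : ℕ) : ℝ) + (j' : ℕ) - ε * (j : ℕ) * (j' : ℕ)) (by fun_prop)
    (by linarith)] with ε hε h
  have hε : 0 < ε := hε
  have key : orientDet (spikePoint u v ε (some (i, j))) (spikePoint u v ε (some (i, j')))
      (spikePoint u v ε none) = ε ^ 2 * (((j' : ℕ) : ℝ) - (j : ℕ)) *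
        (((j : ℕ) : ℝ) + (j' : ℕ) - ε * (j : ℕ) * (j' : ℕ)) := by
    simp only [orientDet, spikePoint]
    linear_combination (ε ^ 2 * (((j' : ℕ) : ℝ) - (j : ℕ)) *
        (((j : ℕ) : ℝ) + (j' : ℕ) - ε * (j : ℕ) * (j' : ℕ))) * huv i
  rw [key]
  have := sub_pos.2 hj'
  positivity

/-- The bracketed factor determines on which side of the spike `i` the point `y` lies. -/
lemma orientDet_spikePoint (ε : ℝ) (i : ι) (j j' : Fin 6) (y : ℝ × ℝ) :
    orientDet (spikePoint u v ε (some (i, j))) (spikePoint u v ε (some (i, j'))) y =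
      ε * (((j' : ℕ) : ℝ) - (j : ℕ)) *
        ((-u i - ε * (((j : ℕ) : ℝ) + (j' : ℕ)) * v i) *
            (y.2 - (spikePoint u v ε (some (i, j))).2) -
          (-v i + ε * (((j : ℕ) : ℝ) + (j' : ℕ)) * u i) *
            (y.1 - (spikePoint u v ε (some (i, j))).1)) := by
  simp only [orientDet, spikePoint]
  ring

lemma continuous_side (i a : ι) (j j' l : Fin 6) : Continuous fun ε =>
    (-u i - ε * (((j : ℕ) : ℝ) + (j' : ℕ)) * v i) *
        ((spikePoint u v ε (some (a, l))).2 - (spikePoint u v ε (some (i, j))).2) -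
      (-v i + ε * (((j : ℕ) : ℝ) + (j' : ℕ)) * u i) *
        ((spikePoint u v ε (some (a, l))).1 - (spikePoint u v ε (some (i, j))).1) := by
  have h1 := continuous_spikePoint_fst (u := u) (v := v)
  have h2 := continuous_spikePoint_snd (u := u) (v := v)
  exact (Continuous.mul (by fun_prop) ((h2 _).sub (h2 _))).sub
    (Continuous.mul (by fun_prop) ((h1 _).sub (h1 _)))

lemma eventually_orientDet_left_pos {a i : ι} {j j' : Fin 6} (l : Fin 6)
    (h : 0 < u a * v i - v a * u i) (hj : j < j') :
    ∀ᶠ ε in 𝓝[>] 0, 0 < orientDet (spikePoint u v ε (some (i, j)))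
      (spikePoint u v ε (some (i, j'))) (spikePoint u v ε (some (a, l))) := by
  have hj' : (0 : ℝ) < (j' : ℕ) - (j : ℕ) := sub_pos.2 (by exact_mod_cast hj)
  filter_upwards [self_mem_nhdsWithin, eventually_pos_of_continuous
    (continuous_side (u := u) (v := v) i a j j' l)
    (by simp only [spikePoint_zero_some]; linarith)] with ε hε hpos
  rw [orientDet_spikePoint]
  exact mul_pos (mul_pos hε hj') hpos

lemma eventually_orientDet_right_neg {i b : ι} {j j' : Fin 6} (l : Fin 6)
    (h : 0 < u i * v b - v i * u b) (hj : j < j') :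
    ∀ᶠ ε in 𝓝[>] 0, orientDet (spikePoint u v ε (some (i, j)))
      (spikePoint u v ε (some (i, j'))) (spikePoint u v ε (some (b, l))) < 0 := by
  have hj' : (0 : ℝ) < (j' : ℕ) - (j : ℕ) := sub_pos.2 (by exact_mod_cast hj)
  filter_upwards [self_mem_nhdsWithin, eventually_pos_of_continuous
    (continuous_side (u := u) (v := v) i b j j' l).neg
    (by simp only [Pi.neg_apply, spikePoint_zero_some]; linarith)] with ε hε hpos
  rw [orientDet_spikePoint]
  exact mul_neg_of_pos_of_neg (mul_pos hε hj') (neg_pos.1 hpos)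

lemma eventually_orientDet_three_pos (huv : ∀ i, u i ^ 2 + v i ^ 2 = 1) {a i b : ι}
    (j l m : Fin 6) (hai : 0 < u a * v i - v a * u i) (hib : 0 < u i * v b - v i * u b) :
    ∀ᶠ ε in 𝓝[>] 0, 0 < orientDet (spikePoint u v ε (some (i, j)))
      (spikePoint u v ε (some (b, l))) (spikePoint u v ε (some (a, m))) := by
  refine eventually_orientDet_pos ?_
  have h1 := mul_pos hib (sub_pos.2 (dot_lt_one huv hai.ne'))
  have h2 := mul_pos hai (sub_pos.2 (dot_lt_one huv hib.ne'))
  have h3 := cross_eq_add huv a i b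
  simp only [spikePoint_zero_some, orientDet]
  linarith

lemma eventually_orientDet_center_two_pos {a i : ι} (l j : Fin 6)
    (h : 0 < u a * v i - v a * u i) :
    ∀ᶠ ε in 𝓝[>] 0, 0 < orientDet (spikePoint u v ε none)
      (spikePoint u v ε (some (a, l))) (spikePoint u v ε (some (i, j))) := by
  refine eventually_orientDet_pos ?_
  simp only [spikePoint_zero_some, orientDet]
  simpa [spikePoint] using h

lemma eventually_tip (huv : ∀ i, u i ^ 2 + v i ^ 2 = 1)
    (hne : ∀ a b, a ≠ b → u a * v b - v a * u b ≠ 0) (i : ι) (j : Fin 6)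
    (q : Option (ι × Fin 6)) (hq : q ≠ some (i, j)) (hlt : ∀ t < j, q ≠ some (i, t)) :
    ∀ᶠ ε in 𝓝[>] 0, u i * (spikePoint u v ε q).1 + v i * (spikePoint u v ε q).2 <
      u i * (spikePoint u v ε (some (i, j))).1 + v i * (spikePoint u v ε (some (i, j))).2 := by
  have h1 := continuous_spikePoint_fst (u := u) (v := v)
  have h2 := continuous_spikePoint_snd (u := u) (v := v)
  by_cases hqi : ∃ t, q = some (i, t)
  · obtain ⟨t, rfl⟩ := hqi
    have htj : j < t := by
      refine lt_of_le_of_ne (not_lt.1 fun h => hlt t h rfl) fun e => hq (by rw [e])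
    have htj' : ((j : ℕ) : ℝ) < (t : ℕ) := by exact_mod_cast htj
    filter_upwards [self_mem_nhdsWithin] with ε hε
    have hε : 0 < ε := hε
    have key : ∀ s : Fin 6, u i * (spikePoint u v ε (some (i, s))).1 +
        v i * (spikePoint u v ε (some (i, s))).2 = 1 - ε * (s : ℕ) := by
      intro s
      simp only [spikePoint]
      linear_combination (1 - ε * (s : ℕ)) * huv i
    rw [key, key]
    nlinarith
  · refine (eventually_pos_of_continuous (f := fun ε =>
      u i * (spikePoint u v ε (some (i, j))).1 + v i * (spikePoint u v ε (some (i, j))).2 -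
        (u i * (spikePoint u v ε q).1 + v i * (spikePoint u v ε q).2)) ?_ ?_).mono
      fun ε hε => sub_pos.1 hε
    · exact ((continuous_const.mul (h1 _)).add (continuous_const.mul (h2 _))).sub
        ((continuous_const.mul (h1 _)).add (continuous_const.mul (h2 _)))
    · have hi := huv i
      rcases q with _ | ⟨a, l⟩
      · simp only [spikePoint_zero_some]
        simp only [spikePoint]
        nlinarith
      · have := dot_lt_one huv (hne i a fun e => hqi ⟨l, by rw [e]⟩)
        simp only [spikePoint_zero_some]
        nlinarith

lemma exists_isSpikedCake [Fintype ι] {k : ℕ} (huv : ∀ i, u i ^ 2 + v i ^ 2 = 1)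
    (hne : ∀ a b, a ≠ b → u a * v b - v a * u b ≠ 0)
    (hk : ∀ i, (Finset.univ.filter fun b => 0 < u i * v b - v i * u b).card ≤ k) :
    ∃ pt : Option (ι × Fin 6) ↪ ℝ × ℝ,
      IsSpikedCake pt (fun a b => 0 < u a * v b - v a * u b) k := by
  have hev : ∀ᶠ ε : ℝ in 𝓝[>] 0, 0 < ε ∧
      (∀ i (j j' : Fin 6), j < j' → 0 < orientDet (spikePoint u v ε (some (i, j)))
        (spikePoint u v ε (some (i, j'))) (spikePoint u v ε none)) ∧
      (∀ a i (j j' l : Fin 6), 0 < u a * v i - v a * u i → j < j' →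
        0 < orientDet (spikePoint u v ε (some (i, j)))
          (spikePoint u v ε (some (i, j'))) (spikePoint u v ε (some (a, l)))) ∧
      (∀ i b (j j' l : Fin 6), 0 < u i * v b - v i * u b → j < j' →
        orientDet (spikePoint u v ε (some (i, j)))
          (spikePoint u v ε (some (i, j'))) (spikePoint u v ε (some (b, l))) < 0) ∧
      (∀ a i b (j l m : Fin 6), 0 < u a * v i - v a * u i → 0 < u i * v b - v i * u b →
        0 < orientDet (spikePoint u v ε (some (i, j)))
          (spikePoint u v ε (some (b, l))) (spikePoint u v ε (some (a, m)))) ∧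
      (∀ a i (l j : Fin 6), 0 < u a * v i - v a * u i → 0 < orientDet (spikePoint u v ε none)
        (spikePoint u v ε (some (a, l))) (spikePoint u v ε (some (i, j)))) ∧
      (∀ i (j : Fin 6) q, q ≠ some (i, j) → (∀ t < j, q ≠ some (i, t)) →
        u i * (spikePoint u v ε q).1 + v i * (spikePoint u v ε q).2 <
          u i * (spikePoint u v ε (some (i, j))).1 +
            v i * (spikePoint u v ε (some (i, j))).2) := by
    simp only [eventually_and, eventually_all]
    exact ⟨self_mem_nhdsWithin, fun i _ _ => eventually_orientDet_center_pos huv i,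
      fun _ _ _ _ l => eventually_orientDet_left_pos l,
      fun _ _ _ _ l => eventually_orientDet_right_neg l,
      fun _ _ _ => eventually_orientDet_three_pos huv,
      fun _ _ => eventually_orientDet_center_two_pos,
      eventually_tip huv hne⟩
  obtain ⟨ε, hε, hcenter, hleft, hright, hthree, htwo, htip⟩ := hev.exists
  have hinj : Function.Injective (spikePoint u v ε) := by
    have key : ∀ i j q, q ≠ some (i, j) → (∀ t < j, q ≠ some (i, t)) →
        spikePoint u v ε q ≠ spikePoint u v ε (some (i, j)) := fun i j q h h' e =>
      (htip i j q h h').ne (by rw [e])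
    intro x y hxy
    by_contra hne
    rcases x with _ | ⟨i, j⟩
    · rcases y with _ | ⟨i, j⟩
      · exact hne rfl
      · exact key i j none hne (by simp) hxy
    by_cases h : ∀ t < j, y ≠ some (i, t)
    · exact key i j y (Ne.symm hne) h hxy.symm
    · push Not at h
      obtain ⟨t, htj, rfl⟩ := h
      refine key i t _ hne (fun t' ht' e => ?_) hxy
      simp only [Option.some.injEq, Prod.mk.injEq, true_and] at e
      omega
  refine ⟨⟨spikePoint u v ε, hinj⟩, ?_⟩
  constructor
  case within =>
    intro i j j' j'' h h'
    have h1 : (0 : ℝ) < (j' : ℕ) - (j : ℕ) := sub_pos.2 (by exact_mod_cast h)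
    have h2 : (0 : ℝ) < (j'' : ℕ) - (j' : ℕ) := sub_pos.2 (by exact_mod_cast h')
    have h3 : (0 : ℝ) < (j'' : ℕ) - (j : ℕ) := by linarith
    simp only [Function.Embedding.coeFn_mk]
    rw [orientDet_spikePoint_within huv, neg_lt_zero]
    positivity
  case irrefl => exact fun i h => by linarith
  case asymm => exact fun a b h h' => by linarith
  case total =>
    intro a b hab
    rcases lt_or_gt_of_ne (hne a b hab) with h | h
    · exact Or.inr (by linarith)
    · exact Or.inl h
  case not_cycle_out =>
    intro i a b c ha hb hc hab hbc hca
    have := mul_pos ha hbc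
    have := mul_pos hb hca
    have := mul_pos hc hab
    nlinarith
  case not_cycle_in =>
    intro i a b c ha hb hc hab hbc hca
    have := mul_pos ha hbc
    have := mul_pos hb hca
    have := mul_pos hc hab
    nlinarith
  case card_out_le => exact hk
  case left => exact hleft
  case right => exact hright
  case center => exact hcenter
  case three => exact hthree
  case center_two => exact htwo
  case tip => exact fun i j => ⟨u i, v i, htip i j⟩

end Coordinates

lemma exists_isSpikedCake_zmod (k : ℕ) :
    ∃ (pt : Option (ZMod (2 * k + 1) × Fin 6) ↪ ℝ × ℝ)
      (L : ZMod (2 * k + 1) → ZMod (2 * k + 1) → Prop), IsSpikedCake pt L k := by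
  set e : AddChar (ZMod (2 * k + 1)) ℂ := ZMod.stdAddChar
  have hnorm : ∀ i, (e i).re ^ 2 + (e i).im ^ 2 = 1 := by
    intro i
    have : Complex.normSq (e i) = 1 := by
      rw [Complex.normSq_eq_norm_sq, AddChar.norm_apply, one_pow]
    rw [Complex.normSq_apply] at this
    linarith
  have hsub : ∀ a b, (e a).re * (e b).im - (e a).im * (e b).re = (e (b - a)).im := by
    intro a b
    have h1 : e b = e (b - a) * e a := by rw [← AddChar.map_add_eq_mul, sub_add_cancel]
    rw [h1, Complex.mul_im, Complex.mul_re]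
    linear_combination (e (b - a)).im * hnorm a
  have hneg : ∀ d, (e (-d)).im = -(e d).im := by
    intro d
    have h1 := hsub d 0
    have h2 := hsub 0 d
    simp only [zero_sub, sub_zero] at h1 h2
    linarith
  have hodd : Nat.Coprime 2 (2 * k + 1) := by simp
  have hzero : ∀ d, (e d).im = 0 → d = 0 := by
    intro d hd
    have h1 : e (d + d) = e 0 := by
      have := hnorm d
      rw [AddChar.map_add_eq_mul, AddChar.map_zero_eq_one]
      apply Complex.ext
      · rw [hd] at this
        rw [Complex.mul_re, hd, Complex.one_re]
        linarith
      · simp [hd]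
    have h2 : (2 : ZMod (2 * k + 1)) * d = 0 := by
      refine (two_mul d).trans ?_
      exact ZMod.injective_stdAddChar h1
    have h3 : IsUnit (2 : ZMod (2 * k + 1)) := by
      exact_mod_cast (ZMod.isUnit_iff_coprime 2 (2 * k + 1)).2 hodd
    exact h3.mul_right_eq_zero.1 h2
  obtain ⟨pt, hpt⟩ := exists_isSpikedCake (k := k) hnorm
    (fun a b hab h => hab (sub_eq_zero.1 (hzero _ ((hsub a b).symm.trans h))).symm) (fun i => by
      simp only [hsub]
      set A := Finset.univ.filter fun b => 0 < (e (b - i)).im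
      set B := Finset.univ.filter fun b => (e (b - i)).im < 0
      have hAB : A.card ≤ B.card := by
        refine Finset.card_le_card_of_injOn (fun b => i - (b - i)) ?_ ?_
        · intro b hb
          simp only [A, B, Finset.mem_coe, Finset.mem_filter, Finset.mem_univ, true_and] at hb ⊢
          rw [sub_right_comm, sub_self, zero_sub, hneg]
          linarith
        · intro b _ c _ h
          simpa using h
      have hdisj : Disjoint A B := Finset.disjoint_filter.2 fun b _ h => h.not_gt
      have hi : i ∉ A ∪ B := by simp [A, B]
      have hcard := Finset.card_le_univ (insert i (A ∪ B))
      rw [Finset.card_insert_of_notMem hi, Finset.card_union_of_disjoint hdisj, ZMod.card] at hcard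
      omega)
  exact ⟨pt, _, hpt⟩

/-- For every `p ∈ ℕ` there is an odd-sized cake `𝒞` with `R(𝒞) ≥ p` and
`M(𝒞) ≥ (3/4)·R(𝒞) − 1/2`; hence the limsup of `M(𝒞)/R(𝒞)` over odd-sized cakes with
`R(𝒞) = p`, as `p → ∞`, is at least `3/4`. -/
theorem statement6 (p : ℕ) :
    ∃ (C : Finset (ℝ × ℝ)) (w : ℝ × ℝ → ℕ),
      (∀ q, w q ≤ 1) ∧ GenPos (↑C : Set (ℝ × ℝ)) ∧ Odd C.card ∧
      p ≤ (C.filter (fun q => w q = 1)).card ∧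
      (3 : ℚ) / 4 * ((C.filter (fun q => w q = 1)).card : ℚ) - 1 / 2
        ≤ (gameM w C : ℚ) := by
  obtain ⟨pt, L, H⟩ := exists_isSpikedCake_zmod p
  set reds : Finset (Option (ZMod (2 * p + 1) × Fin 6)) := Finset.univ.filter IsRed with hreds
  set w : ℝ × ℝ → ℕ := fun q => if q ∈ reds.map pt then 1 else 0 with hw
  have hcard : 4 * p + 2 ≤ reds.card := by
    have h := Finset.card_le_card_of_injOn (s := (Finset.univ : Finset (ZMod (2 * p + 1) × Bool)))
      (t := reds) (fun x => some (x.1, bif x.2 then 1 else 3))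
      (fun x _ => by
        rcases x with ⟨i, _ | _⟩ <;> simp [hreds, IsRed])
      (fun x _ y _ hxy => by
        rcases x with ⟨i, _ | _⟩ <;> rcases y with ⟨i', _ | _⟩ <;> simp at hxy ⊢ <;> exact hxy)
    rw [Finset.card_univ, Fintype.card_prod, ZMod.card, Fintype.card_bool] at h
    omega
  have hw1 : ∀ q, w q = 1 ↔ q ∈ reds.map pt := fun q => by simp [hw]
  have hfilter : (Finset.univ.map pt).filter (fun q => w q = 1) = reds.map pt := by
    ext q
    rw [Finset.mem_filter, hw1, and_iff_right_iff_imp]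
    exact fun hq => Finset.map_subset_map.2 (Finset.subset_univ _) hq
  have hgame := H.card_isRed_le_gameM_add (w := w)
    (fun i => (hw1 _).2 (Finset.mem_map_of_mem _ (by simp [hreds, IsRed])))
    (fun i => (hw1 _).2 (Finset.mem_map_of_mem _ (by simp [hreds, IsRed])))
    Finset.univ ⟨Finset.mem_univ _, fun i => ⟨0, fun j => by simp⟩⟩
  refine ⟨Finset.univ.map pt, w, fun q => ?_, ?_, ?_, ?_, ?_⟩
  · simp only [hw]
    split_ifs <;> simp
  · simp only [Finset.coe_map, Finset.coe_univ, Set.image_univ]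
    rintro _ ⟨x, rfl⟩ _ ⟨y, rfl⟩ _ ⟨z, rfl⟩ hxy hxz hyz
    exact H.orientDet_ne_zero (ne_of_apply_ne pt hxy) (ne_of_apply_ne pt hxz)
      (ne_of_apply_ne pt hyz)
  · rw [Finset.card_map, Finset.card_univ, Fintype.card_option, Fintype.card_prod, ZMod.card,
      Fintype.card_fin]
    exact ⟨3 * (2 * p + 1), by ring⟩
  · rw [hfilter, Finset.card_map]
    omega
  · rw [hfilter, Finset.card_map]
    have h1 : (reds.card : ℚ) ≤ gameM w (Finset.univ.map pt) + (p + 1) := by exact_mod_cast hgame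
    have h2 : (4 * p + 2 : ℚ) ≤ reds.card := by exact_mod_cast hcard
    linarith

end
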